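/- Let C = (c_0, …, c_n) be a 1D crease pattern and α = (c_i, …, c_{i+k}) a crimpable sequence of C with gap d. Consider any maximal sequence of monocrimps, each performed at an adjacent pair of the creases of α remaining at that stage (such pairs always satisfy the monocrimp condition). If k + 1 is even, then all k + 1 creases of α are removed, exactly (k+1)/2 monocrimps are performed, and the resulting crease pattern is (c_0, …, c_{i−1}, c_{i+k+1} − (k+1)d, …, c_n − (k+1)d). If k + 1 is odd, then exactly one crease of α survives, exactly k/2 monocrimps are performed, the surviving crease ends at position c_i, and the resulting crease pattern is (c_0, …, c_{i−1}, c_i, c_{i+k+1} − kd, …, c_n − kd). In particular, the positions in the resulting crease pattern are independent of which adjacent pairs were chosen. -/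

import Mathlib

/-- Mountain or valley label for a crease. -/
inductive MV : Type
  | M : MV
  | V : MV
deriving DecidableEq

/-- `(c 0, c 1, …, c n)` is a 1D crease pattern: a strictly increasing finite
sequence of reals with `n ≥ 1`.  The points `c 1, …, c (n-1)` are its creases,
`c 0` and `c n` its ends. -/
def IsCreasePattern (n : ℕ) (c : ℕ → ℝ) : Prop :=
  1 ≤ n ∧ ∀ i j : ℕ, i < j → j ≤ n → c i < c j

/-- The consecutive creases `(c i, …, c (i+k))` form a crimpable sequence with gap `d`. -/
def IsCrimpable (n : ℕ) (c : ℕ → ℝ) (i k : ℕ) (d : ℝ) : Prop :=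
  1 ≤ i ∧ 1 ≤ k ∧ i + k ≤ n - 1 ∧
  (∀ m : ℕ, i ≤ m → m < i + k → c (m + 1) - c m = d) ∧
  d < c i - c (i - 1) ∧ d < c (i + k + 1) - c (i + k)

/-- Additive offset of the folded-position map on the `j`-th interval:
on `[c j, c (j+1)]` the folded-position map is `x ↦ (-1)^j * x + foldOffset c j`. -/
def foldOffset (c : ℕ → ℝ) : ℕ → ℝ
  | 0 => 0
  | j + 1 => foldOffset c (j) + 2 * (-1 : ℝ) ^ j * c (j + 1)

/-- Folded position of a point `x` belonging to the `j`-th interval `[c j, c (j+1)]`.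
This is the unique continuous map equal to the identity on `[c 0, c 1]`, isometric on
every interval, and reversing direction at every crease. -/
def foldPos (c : ℕ → ℝ) (j : ℕ) (x : ℝ) : ℝ := (-1 : ℝ) ^ j * x + foldOffset c j

/-- Folded position of the crease `c i`. -/
def foldCrease (c : ℕ → ℝ) (i : ℕ) : ℝ := foldPos c i (c i)

/-- `x` lies strictly `lt`-between `a` and `b`. -/
def Between (lt : ℕ → ℕ → Prop) (a b x : ℕ) : Prop :=
  (lt a x ∧ lt x b) ∨ (lt b x ∧ lt x a)

/-- The MV pattern `(C, μ)` is flat-foldable: there is a strict linear order `lt`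
("strictly below") on the intervals `I_0, …, I_{n-1}` (indexed `0, …, n-1`) such that:
(i) for each crease `i`, `I_{i-1}` is below `I_i` iff either `μ i = V` and the folded map
is increasing on `I_{i-1}` (slope `(-1)^(i-1) = 1`), or `μ i = M` and it is decreasing;
(ii) for each crease `i` and each interval `J` whose folded image contains the folded
crease position in its interior, `J` is not strictly between `I_{i-1}` and `I_i`;
(iii) for distinct creases `i, j` folding to the same point, it is not the case that
exactly one of `I_{j-1}`, `I_j` is strictly between `I_{i-1}` and `I_i`. -/
def IsFlatFoldable (n : ℕ) (c : ℕ → ℝ) (μ : ℕ → MV) : Prop :=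
  ∃ lt : ℕ → ℕ → Prop,
    (∀ j, j < n → ¬ lt j j) ∧
    (∀ a b e, lt a b → lt b e → lt a e) ∧
    (∀ a b, a < n → b < n → a ≠ b → lt a b ∨ lt b a) ∧
    (∀ a b, lt a b → a < n ∧ b < n) ∧
    (∀ i, 1 ≤ i → i ≤ n - 1 →
      (lt (i - 1) i ↔ ((μ i = MV.V ∧ Even (i - 1)) ∨ (μ i = MV.M ∧ Odd (i - 1))))) ∧
    (∀ i, 1 ≤ i → i ≤ n - 1 → ∀ j, j < n →
      foldCrease c i ∈
        Set.Ioo (min (foldPos c j (c j)) (foldPos c j (c (j + 1))))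
                (max (foldPos c j (c j)) (foldPos c j (c (j + 1)))) →
      ¬ Between lt (i - 1) i j) ∧
    (∀ i j, 1 ≤ i → i ≤ n - 1 → 1 ≤ j → j ≤ n - 1 → i ≠ j →
      foldCrease c i = foldCrease c j →
      (Between lt (i - 1) i (j - 1) ↔ Between lt (i - 1) i j))

/-- `F` is a forcing set for the MV pattern `(C, μ)`: a set of creases such that the only
flat-foldable assignment agreeing with `μ` on `F` is `μ` itself (on all creases). -/
def IsForcingSet (n : ℕ) (c : ℕ → ℝ) (μ : ℕ → MV) (F : Set ℕ) : Prop :=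
  F ⊆ Set.Icc 1 (n - 1) ∧
  ∀ ν : ℕ → MV, IsFlatFoldable n c ν → (∀ x ∈ F, ν x = μ x) →
    ∀ x, 1 ≤ x → x ≤ n - 1 → ν x = μ x

/-- The crease pattern produced by a monocrimp at the adjacent pair `(c j, c (j+1))`:
it deletes `c j` and `c (j+1)` and translates all later points by `-2 * (c (j+1) - c j)`. -/
def monocrimpPattern (c : ℕ → ℝ) (j : ℕ) : ℕ → ℝ :=
  fun x => if x < j then c x else c (x + 2) - 2 * (c (j + 1) - c j)

/-- A state of the folding process: the set of surviving (alive) indices of the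
original crease pattern, together with the current positions of the points.
Creases keep their identity (original index) while their positions shift. -/
structure PState where
  alive : Finset ℕ
  pos : ℕ → ℝ

/-- `a` and `b` are adjacent surviving points (no survivor strictly between them). -/
def Adjacent (s : Finset ℕ) (a b : ℕ) : Prop :=
  a ∈ s ∧ b ∈ s ∧ a < b ∧ ∀ x ∈ s, ¬ (a < x ∧ x < b)

/-- A monocrimp at the adjacent surviving pair `(a, b)`: the two neighboring intervals
are at least as long as the middle one; `a`, `b` are deleted and all later points are
translated by `-2 * (pos b - pos a)`. -/
def Monocrimp (a b : ℕ) (S T : PState) : Prop :=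
  Adjacent S.alive a b ∧
  (∃ l, Adjacent S.alive l a ∧ S.pos b - S.pos a ≤ S.pos a - S.pos l) ∧
  (∃ r, Adjacent S.alive b r ∧ S.pos b - S.pos a ≤ S.pos r - S.pos b) ∧
  T.alive = S.alive \ {a, b} ∧
  T.pos = fun x => if b < x then S.pos x - 2 * (S.pos b - S.pos a) else S.pos x

/-- The set `α` of surviving creases forms a crimpable sequence with gap `d` in state `S`:
`α` is a set of consecutive survivors, equally spaced at distance `d`, and the intervals
adjacent to its two ends are strictly longer than `d`. -/
def CrimpableIn (S : PState) (α : Finset ℕ) (d : ℝ) : Prop :=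
  ∃ lo hi, lo ∈ α ∧ hi ∈ α ∧ (∀ x ∈ α, lo ≤ x ∧ x ≤ hi) ∧ 2 ≤ α.card ∧
    α ⊆ S.alive ∧
    (∀ x ∈ S.alive, lo ≤ x → x ≤ hi → x ∈ α) ∧
    (∀ a b, a ∈ α → b ∈ α → Adjacent S.alive a b → S.pos b - S.pos a = d) ∧
    (∃ l, Adjacent S.alive l lo ∧ d < S.pos lo - S.pos l) ∧
    (∃ r, Adjacent S.alive hi r ∧ d < S.pos r - S.pos hi)

/-- A monocrimp step performed at an adjacent pair of the remaining creases of `α`. -/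
def StepIn (α : Finset ℕ) (S T : PState) : Prop :=
  ∃ a b, a ∈ α ∧ b ∈ α ∧ Monocrimp a b S T

/-- A monocrimp step at an adjacent pair of remaining creases of `α` of opposite μ-value. -/
def StepInMV (μ : ℕ → MV) (α : Finset ℕ) (S T : PState) : Prop :=
  ∃ a b, a ∈ α ∧ b ∈ α ∧ μ a ≠ μ b ∧ Monocrimp a b S T

/-- A crimp operation on the crimpable sequence `α`: a sequence of monocrimps at adjacent
pairs of the remaining creases of `α` until no crease or exactly one crease of `α` remains. -/
def CrimpOp (α : Finset ℕ) (S T : PState) : Prop :=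
  (∃ d, CrimpableIn S α d) ∧
  (∃ (m : ℕ) (W : ℕ → PState), W 0 = S ∧ W m = T ∧ (∀ t, t < m → StepIn α (W t) (W (t + 1)))) ∧
  ((T.alive ∩ α).card ≤ 1)

/-- A crimp operation on `α` in which every monocrimp pair has opposite μ-values. -/
def CrimpOpMV (μ : ℕ → MV) (α : Finset ℕ) (S T : PState) : Prop :=
  (∃ d, CrimpableIn S α d) ∧
  (∃ (m : ℕ) (W : ℕ → PState), W 0 = S ∧ W m = T ∧ (∀ t, t < m → StepInMV μ α (W t) (W (t + 1)))) ∧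
  ((T.alive ∩ α).card ≤ 1)

/-- The initial state of the crease pattern `(c 0, …, c n)`. -/
def initState (n : ℕ) (c : ℕ → ℝ) : PState := ⟨Finset.range (n + 1), c⟩

/-- `S 0, …, S m` is a sequence of crimp operations performed on `(c 0, …, c n)`,
with the `t`-th crimp performed on the crimpable sequence `α t`. -/
def CrimpSeq (n : ℕ) (c : ℕ → ℝ) (m : ℕ) (α : ℕ → Finset ℕ) (S : ℕ → PState) : Prop :=
  S 0 = initState n c ∧ ∀ t, t < m → CrimpOp (α t) (S t) (S (t + 1))

/-- Same, where every monocrimp is performed at a pair of creases of opposite μ-value. -/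
def CrimpSeqMV (μ : ℕ → MV) (n : ℕ) (c : ℕ → ℝ) (m : ℕ)
    (α : ℕ → Finset ℕ) (S : ℕ → PState) : Prop :=
  S 0 = initState n c ∧ ∀ t, t < m → CrimpOpMV μ (α t) (S t) (S (t + 1))

/-- The state contains no crimpable sequence (the sequence of crimps was exhaustive). -/
def Exhausted (S : PState) : Prop := ¬ ∃ α d, CrimpableIn S α d

/-- The number of elements of `A` below `x`. -/
def rankIn (A : Finset ℕ) (x : ℕ) : ℕ := (A.filter (· < x)).card

theorem rankIn_eq_zero {A : Finset ℕ} {x : ℕ} (h : ∀ y ∈ A, x ≤ y) : rankIn A x = 0 := by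
  simpa [rankIn, Finset.filter_eq_empty_iff] using h

theorem rankIn_eq_succ {A : Finset ℕ} {a b : ℕ} (h : Adjacent A a b) :
    rankIn A b = rankIn A a + 1 := by
  obtain ⟨ha, hb, hab, hbet⟩ := h
  have : A.filter (· < b) = insert a (A.filter (· < a)) := by
    ext x
    have := hbet x
    simp only [Finset.mem_filter, Finset.mem_insert]
    grind
  rw [rankIn, this, Finset.card_insert_of_notMem (by simp), rankIn]

theorem rankIn_sdiff_of_le {A : Finset ℕ} {a b x : ℕ} (hab : a < b) (hx : x ≤ a) :
    rankIn (A \ {a, b}) x = rankIn A x := by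
  unfold rankIn
  congr 1
  ext y
  simp only [Finset.mem_filter, Finset.mem_sdiff, Finset.mem_insert, Finset.mem_singleton]
  grind

theorem rankIn_sdiff_of_lt {A : Finset ℕ} {a b x : ℕ} (ha : a ∈ A) (hb : b ∈ A) (hab : a < b)
    (hx : b < x) : rankIn (A \ {a, b}) x + 2 = rankIn A x := by
  have : A.filter (· < x) = insert a (insert b ((A \ {a, b}).filter (· < x))) := by
    ext y
    simp only [Finset.mem_filter, Finset.mem_sdiff, Finset.mem_insert, Finset.mem_singleton]
    grind
  rw [rankIn, rankIn, this, Finset.card_insert_of_notMem (by simp [hab.ne]),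
    Finset.card_insert_of_notMem (by simp)]

theorem adjacent_min'_min'_erase {A : Finset ℕ} (hA : A.Nonempty)
    (hA' : (A.erase (A.min' hA)).Nonempty) :
    Adjacent A (A.min' hA) ((A.erase (A.min' hA)).min' hA') := by
  have hmem := (A.erase (A.min' hA)).min'_mem hA'
  rw [Finset.mem_erase] at hmem
  refine ⟨A.min'_mem hA, hmem.2, lt_of_le_of_ne (A.min'_le _ hmem.2) hmem.1.symm, ?_⟩
  rintro x hx ⟨h1, h2⟩
  exact absurd ((A.erase _).min'_le x (Finset.mem_erase.2 ⟨h1.ne', hx⟩)) (not_le.2 h2)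

theorem IsCrimpable.apply_add {n : ℕ} {c : ℕ → ℝ} {i k : ℕ} {d : ℝ} (h : IsCrimpable n c i k d)
    {j : ℕ} (hj : j ≤ k) : c (i + j) = c i + j * d := by
  induction j with
  | zero => simp
  | succ j ih =>
    have h1 := h.2.2.2.1 (i + j) (by omega) (by omega)
    have h2 := ih (by omega)
    rw [← add_assoc]
    push_cast
    linarith

/-- State `S` arises from `(c 0, …, c n)` after `t` monocrimps within `(c i, …, c (i+k))`,
the set `A` of creases of this sequence having survived. -/
structure PartlyCrimped (n : ℕ) (c : ℕ → ℝ) (i k : ℕ) (d : ℝ) (t : ℕ) (S : PState)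
    (A : Finset ℕ) : Prop where
  subset : A ⊆ Finset.Icc i (i + k)
  alive_eq : S.alive = (Finset.range (n + 1) \ Finset.Icc i (i + k)) ∪ A
  card : A.card + 2 * t = k + 1
  pos_mem : ∀ x ∈ A, S.pos x = c i + rankIn A x * d
  pos_lt : ∀ x, x < i → S.pos x = c x
  pos_gt : ∀ x, i + k < x → S.pos x = c x - 2 * t * d

namespace PartlyCrimped

variable {n : ℕ} {c : ℕ → ℝ} {i k : ℕ} {d : ℝ} {t : ℕ} {S T : PState} {A : Finset ℕ}

theorem init (hα : IsCrimpable n c i k d) :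
    PartlyCrimped n c i k d 0 (initState n c) (Finset.Icc i (i + k)) where
  subset := subset_rfl
  alive_eq := by
    have := hα.2.2.1
    have := hα.1
    ext x
    simp only [initState, Finset.mem_union, Finset.mem_sdiff, Finset.mem_range, Finset.mem_Icc]
    omega
  card := by
    rw [Nat.card_Icc]
    omega
  pos_mem x hx := by
    obtain ⟨h1, h2⟩ := Finset.mem_Icc.1 hx
    obtain ⟨j, rfl⟩ := Nat.exists_eq_add_of_le h1
    have hr : (Finset.Icc i (i + k)).filter (· < i + j) = Finset.Ico i (i + j) := by
      ext y
      simp only [Finset.mem_filter, Finset.mem_Icc, Finset.mem_Ico]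
      omega
    simp [initState, rankIn, hr, hα.apply_add (show j ≤ k by omega)]
  pos_lt x _ := rfl
  pos_gt x _ := by simp [initState]

theorem mem_alive (h : PartlyCrimped n c i k d t S A) {x : ℕ} :
    x ∈ S.alive ↔ (x < n + 1 ∧ (x < i ∨ i + k < x)) ∨ x ∈ A := by
  rw [h.alive_eq]
  simp only [Finset.mem_union, Finset.mem_sdiff, Finset.mem_range, Finset.mem_Icc]
  grind

theorem mem_Icc (h : PartlyCrimped n c i k d t S A) {x : ℕ} (hx : x ∈ A) :
    i ≤ x ∧ x ≤ i + k :=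
  Finset.mem_Icc.1 (h.subset hx)

theorem mem_of_mem_alive (h : PartlyCrimped n c i k d t S A) {x : ℕ} (hx : x ∈ S.alive)
    (h1 : i ≤ x) (h2 : x ≤ i + k) : x ∈ A := by
  rcases h.mem_alive.1 hx with h | h
  · omega
  · exact h

theorem adjacent_iff (h : PartlyCrimped n c i k d t S A) {a b : ℕ}
    (ha : a ∈ Finset.Icc i (i + k)) (hb : b ∈ Finset.Icc i (i + k)) :
    Adjacent S.alive a b ↔ Adjacent A a b := by
  rw [Finset.mem_Icc] at ha hb
  have key : ∀ x, i ≤ x → x ≤ i + k → (x ∈ S.alive ↔ x ∈ A) := fun x h1 h2 =>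
    ⟨fun hx => h.mem_of_mem_alive hx h1 h2, fun hx => h.mem_alive.2 (Or.inr hx)⟩
  unfold Adjacent
  rw [key a ha.1 ha.2, key b hb.1 hb.2]
  refine and_congr_right fun _ => and_congr_right fun _ => and_congr_right fun _ =>
    forall_congr' fun x => ?_
  by_cases hx : a < x ∧ x < b
  · rw [key x (by omega) (by omega)]
  · simp [hx]

theorem pos_sub_pos (h : PartlyCrimped n c i k d t S A) {a b : ℕ} (hab : Adjacent A a b) :
    S.pos b - S.pos a = d := by
  rw [h.pos_mem a hab.1, h.pos_mem b hab.2.1, rankIn_eq_succ hab]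
  push_cast
  ring

theorem step (h : PartlyCrimped n c i k d t S A) (hST : StepIn (Finset.Icc i (i + k)) S T) :
    ∃ B, PartlyCrimped n c i k d (t + 1) T B := by
  obtain ⟨a, b, ha, hb, hadj, -, -, hTa, hTp⟩ := hST
  rw [h.adjacent_iff ha hb] at hadj
  have hd := h.pos_sub_pos hadj
  obtain ⟨haA, hbA, hab, hbet⟩ := hadj
  rw [Finset.mem_Icc] at ha hb
  refine ⟨A \ {a, b}, Finset.sdiff_subset.trans h.subset, ?_, ?_, ?_, ?_, ?_⟩
  · ext x
    have := h.mem_alive (x := x)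
    rw [hTa]
    simp only [Finset.mem_union, Finset.mem_sdiff, Finset.mem_range, Finset.mem_Icc, this,
      Finset.mem_insert, Finset.mem_singleton]
    grind
  · have hsub : {a, b} ⊆ A := by
      simp [Finset.insert_subset_iff, haA, hbA]
    have h1 := Finset.card_sdiff_add_card_eq_card hsub
    rw [Finset.card_pair hab.ne] at h1
    have := h.card
    omega
  · intro x hx
    simp only [Finset.mem_sdiff, Finset.mem_insert, Finset.mem_singleton, not_or] at hx
    obtain ⟨hxA, hxa, hxb⟩ := hx
    simp only [hTp, hd]
    split_ifs with hlt
    · rw [h.pos_mem x hxA, ← rankIn_sdiff_of_lt haA hbA hab hlt]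
      push_cast
      ring
    · have := hbet x hxA
      rw [h.pos_mem x hxA, rankIn_sdiff_of_le hab (by omega)]
  · intro x hx
    simp only [hTp, if_neg (show ¬ b < x by omega)]
    exact h.pos_lt x hx
  · intro x hx
    simp only [hTp, if_pos (show b < x by omega), hd, h.pos_gt x hx]
    push_cast
    ring

theorem exists_step (h : PartlyCrimped n c i k d t S A) (hα : IsCrimpable n c i k d)
    (hA : 2 ≤ A.card) : ∃ T, StepIn (Finset.Icc i (i + k)) S T := by
  have hne : A.Nonempty := Finset.card_pos.1 (by omega)
  have hcard := Finset.card_erase_of_mem (A.min'_mem hne)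
  have hne' : (A.erase (A.min' hne)).Nonempty := Finset.card_pos.1 (by omega)
  have hadj := adjacent_min'_min'_erase hne hne'
  have hmin : ∀ x ∈ A, A.min' hne ≤ x := fun x hx => A.min'_le x hx
  generalize A.min' hne = a at *
  generalize (A.erase a).min' hne' = b at *
  have haI := h.subset hadj.1
  have hbI := h.subset hadj.2.1
  have hab := (h.adjacent_iff haI hbI).2 hadj
  have hd := h.pos_sub_pos hadj
  have hpa : S.pos a = c i := by
    rw [h.pos_mem a hadj.1, rankIn_eq_zero hmin]
    simp
  have hk := hα.apply_add le_rfl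
  obtain ⟨hi, -, hn, -, hl, hr⟩ := hα
  have ha' := h.mem_Icc hadj.1
  have hb' := h.mem_Icc hadj.2.1
  refine ⟨⟨S.alive \ {a, b},
    fun x => if b < x then S.pos x - 2 * (S.pos b - S.pos a) else S.pos x⟩,
    a, b, haI, hbI, hab, ⟨i - 1, ⟨h.mem_alive.2 (by omega), hab.1, by omega, ?_⟩, ?_⟩, ?_, rfl, rfl⟩
  · rintro x hx ⟨h1, h2⟩
    have := hmin x (h.mem_of_mem_alive hx (by omega) (by omega))
    omega
  · rw [hd, hpa, h.pos_lt (i - 1) (by omega)]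
    exact hl.le
  · rw [hd]
    rcases (A.filter (b < ·)).eq_empty_or_nonempty with he | he
    · refine ⟨i + k + 1, ⟨hab.2.1, h.mem_alive.2 (by omega), by omega, ?_⟩, ?_⟩
      · rintro x hx ⟨h1, h2⟩
        have hxA := h.mem_of_mem_alive hx (by omega) (by omega)
        exact Finset.notMem_empty x (he ▸ Finset.mem_filter.2 ⟨hxA, h1⟩)
      · have hA2 : A = {a, b} := by
          ext x
          simp only [Finset.mem_insert, Finset.mem_singleton]
          refine ⟨fun hx => ?_, by rintro (rfl | rfl); exacts [hadj.1, hadj.2.1]⟩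
          have h1 := hmin x hx
          have h2 := hadj.2.2.2 x hx
          have h3 : ¬ b < x := fun hlt =>
            Finset.notMem_empty x (he ▸ Finset.mem_filter.2 ⟨hx, hlt⟩)
          omega
        have hc := h.card
        rw [hA2, Finset.card_pair hadj.2.2.1.ne] at hc
        have hc' : (2 : ℝ) + 2 * t = k + 1 := by exact_mod_cast hc
        rw [h.pos_gt (i + k + 1) (by omega), show 2 * (t : ℝ) = k - 1 by linarith]
        linarith
    · have hm := Finset.mem_filter.1 ((A.filter (b < ·)).min'_mem he)
      have hbr : Adjacent A b ((A.filter (b < ·)).min' he) := by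
        refine ⟨hadj.2.1, hm.1, hm.2, ?_⟩
        rintro x hx ⟨h1, h2⟩
        exact absurd ((A.filter (b < ·)).min'_le x (Finset.mem_filter.2 ⟨hx, h1⟩)) (not_le.2 h2)
      exact ⟨_, (h.adjacent_iff hbI (h.subset hm.1)).2 hbr, (h.pos_sub_pos hbr).ge⟩

theorem pos_eq_ite (h : PartlyCrimped n c i k d t S A) {x : ℕ} (hx : x ∉ Finset.Icc i (i + k)) :
    S.pos x = if i + k < x then c x - 2 * t * d else c x := by
  rw [Finset.mem_Icc] at hx
  split_ifs with hlt
  · exact h.pos_gt x hlt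
  · exact h.pos_lt x (by omega)

end PartlyCrimped

/-- Crimping a crimpable sequence `α = (c i, …, c (i+k))`: any maximal sequence of
monocrimps performed at adjacent pairs of the remaining creases of `α` removes all
creases of `α` via `(k+1)/2` monocrimps when `k+1` is even, leaving the pattern
`(c 0, …, c (i-1), c (i+k+1) - (k+1)d, …, c n - (k+1)d)`; and when `k+1` is odd it
performs `k/2` monocrimps, exactly one crease of `α` survives at position `c i`, and
the rest of the pattern is `(c 0, …, c (i-1), c i, c (i+k+1) - k*d, …, c n - k*d)`.
In particular the resulting positions are independent of the pairs chosen. -/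
theorem crimp_result (n : ℕ) (c : ℕ → ℝ) (hC : IsCreasePattern n c)
    (i k : ℕ) (d : ℝ) (hα : IsCrimpable n c i k d)
    (m : ℕ) (S : ℕ → PState)
    (hinit : S 0 = initState n c)
    (hstep : ∀ t, t < m → StepIn (Finset.Icc i (i + k)) (S t) (S (t + 1)))
    (hmax : ∀ T, ¬ StepIn (Finset.Icc i (i + k)) (S m) T) :
    (Even (k + 1) →
      m = (k + 1) / 2 ∧
      (S m).alive = Finset.range (n + 1) \ Finset.Icc i (i + k) ∧
      ∀ x ∈ (S m).alive,
        (S m).pos x = if i + k < x then c x - ((k : ℝ) + 1) * d else c x) ∧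
    (Odd (k + 1) →
      m = k / 2 ∧
      ∃ s ∈ Finset.Icc i (i + k),
        (S m).alive = insert s (Finset.range (n + 1) \ Finset.Icc i (i + k)) ∧
        (S m).pos s = c i ∧
        ∀ x ∈ (S m).alive, x ∉ Finset.Icc i (i + k) →
          (S m).pos x = if i + k < x then c x - (k : ℝ) * d else c x) := by
  have hinv : ∀ t, t ≤ m → ∃ A, PartlyCrimped n c i k d t (S t) A := by
    intro t
    induction t with
    | zero => exact fun _ => ⟨_, hinit ▸ PartlyCrimped.init hα⟩
    | succ t ih =>
      intro ht
      obtain ⟨A, hA⟩ := ih (by omega)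
      exact hA.step (hstep t (by omega))
  obtain ⟨A, hA⟩ := hinv m le_rfl
  have hle : A.card ≤ 1 := by
    by_contra hlt
    obtain ⟨T, hT⟩ := hA.exists_step hα (by omega)
    exact hmax T hT
  have hcard := hA.card
  refine ⟨fun hk => ?_, fun hk => ?_⟩
  · obtain ⟨j, hj⟩ := hk
    have hm : 2 * (m : ℝ) = k + 1 := by exact_mod_cast (show 2 * m = k + 1 by omega)
    obtain rfl : A = ∅ := Finset.card_eq_zero.1 (by omega)
    have halive := hA.alive_eq
    rw [Finset.union_empty] at halive
    refine ⟨by omega, halive, fun x hx => ?_⟩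
    rw [halive, Finset.mem_sdiff] at hx
    rw [hA.pos_eq_ite hx.2, hm]
  · obtain ⟨j, hj⟩ := hk
    have hm : 2 * (m : ℝ) = k := by exact_mod_cast (show 2 * m = k by omega)
    obtain ⟨s, rfl⟩ := Finset.card_eq_one.1 (show A.card = 1 by omega)
    refine ⟨by omega, s, hA.subset (Finset.mem_singleton_self s), ?_, ?_, fun x _ hx => ?_⟩
    · rw [hA.alive_eq, Finset.union_comm, Finset.insert_eq]
    · rw [hA.pos_mem s (Finset.mem_singleton_self s), rankIn_eq_zero (by simp)]
      simp
    · rw [hA.pos_eq_ite hx, hm]
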